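/- Let G be a group with a finite symmetric generating set S (e ∉ S) and let P be the lazy simple random walk measure. Suppose there are constants K, L > 0 and ν ∈ (0,1] such that |B_n| ≤ L·exp(K·n^ν) for all n ≥ 1, and suppose there are constants K', L' > 0 and h ∈ (0,1] such that the entropy satisfies H(P^{(n)}) ≥ K' + L'·n^h for all n ≥ 1. Then there is a constant c > 0 such that E|P^{(n)}| ≥ c·n^{h/ν} for all n ≥ 1 (so the speed exponent β satisfies β·ν ≥ h). -/

import Mathlib

open scoped Classical

noncomputable section

/-- Word length of `g` with respect to the generating set `S`
(least `n` such that `g` is a product of `n` elements of `S`). -/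
def wordLength {G : Type*} [Group G] (S : Set G) (g : G) : ℕ :=
  sInf {n | ∃ l : List G, (∀ x ∈ l, x ∈ S) ∧ l.length = n ∧ l.prod = g}

/-- The ball of radius `n` with respect to the generating set `S`. -/
def ball {G : Type*} [Group G] (S : Set G) (n : ℕ) : Set G :=
  {g | wordLength S g ≤ n}

/-- The lazy simple random walk measure `P = (1/2)(δ_e + U_S)`. -/
def lazyWalk {G : Type*} [Group G] (S : Finset G) : G → ℝ := fun g =>
  (if g = 1 then (1 : ℝ) / 2 else 0) + (if g ∈ S then 1 / (2 * (S.card : ℝ)) else 0)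

/-- The `n`-fold convolution power of a measure `P` (with `P^{(0)} = δ_e`). -/
def convPow {G : Type*} [Group G] (P : G → ℝ) : ℕ → G → ℝ
  | 0 => fun g => if g = 1 then 1 else 0
  | n + 1 => fun g => ∑' h : G, convPow P n h * P (h⁻¹ * g)

/-- The speed (expected word length) of the walk at time `n`. -/
def speed {G : Type*} [Group G] (S : Set G) (P : G → ℝ) (n : ℕ) : ℝ :=
  ∑' g : G, convPow P n g * (wordLength S g : ℝ)

/-- The entropy of a measure `Q`, with the convention `0 · ln 0 = 0`. -/
def entropy {G : Type*} [Group G] (Q : G → ℝ) : ℝ :=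
  -∑' g : G, Q g * Real.log (Q g)

/-- A real Hilbert space equipped with an isometric linear `G`-representation and
a cocycle for it: `b (x y) = λ(x) b(y) + b(x)`. -/
structure HilbertCocycle (G : Type*) [Group G] where
  space : Type
  [nacg : NormedAddCommGroup space]
  [ips : InnerProductSpace ℝ space]
  [complete : CompleteSpace space]
  rep : G →* (space ≃ₗᵢ[ℝ] space)
  cocycle : G → space
  cocycle_rel : ∀ x y : G, cocycle (x * y) = rep x (cocycle y) + cocycle x

attribute [instance] HilbertCocycle.nacg HilbertCocycle.ips HilbertCocycle.complete

/-- The set of values at `x` of concave functions on `[0,∞)` dominating `f` on `ℕ`. -/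
def concaveMajorants (f : ℕ → ℝ) (x : ℝ) : Set ℝ :=
  {y | ∃ h : ℝ → ℝ, ConcaveOn ℝ (Set.Ici 0) h ∧ (∀ k : ℕ, f k ≤ h k) ∧ y = h x}

/-- The concave hull of `f : ℕ → ℝ`: the pointwise infimum of concave majorants. -/
def concaveHull (f : ℕ → ℝ) (x : ℝ) : ℝ := sInf (concaveMajorants f x)

/-- The log-volume of the ball of radius `n`. -/
def growthLog {G : Type*} [Group G] (S : Set G) (n : ℕ) : ℝ :=
  Real.log (Nat.card ↥(ball S n))

end

section Walk

variable {G : Type*} [Group G]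

lemma lazyWalk_nonneg (S : Finset G) (g : G) : 0 ≤ lazyWalk S g := by
  unfold lazyWalk
  split_ifs <;> positivity

lemma support_lazyWalk_finite (S : Finset G) : (Function.support (lazyWalk S)).Finite := by
  refine (insert 1 S).finite_toSet.subset fun g hg => ?_
  by_contra hmem
  simp only [Finset.coe_insert, Set.mem_insert_iff, Finset.mem_coe, not_or] at hmem
  exact hg (by simp [lazyWalk, hmem.1, hmem.2])

lemma hasSum_lazyWalk {S : Finset G} (hS : S.Nonempty) : HasSum (lazyWalk S) 1 := by
  have hcard : (S.card : ℝ) ≠ 0 := by exact_mod_cast hS.card_pos.ne'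
  have h1 : HasSum (fun g : G => if g = 1 then (1 : ℝ) / 2 else 0) (1 / 2) :=
    hasSum_ite_eq 1 _
  have h2 : HasSum (fun g : G => if g ∈ S then 1 / (2 * (S.card : ℝ)) else 0) (1 / 2) := by
    have h := hasSum_sum_of_ne_finset_zero (s := S) (L := SummationFilter.unconditional G)
      (f := fun g : G => if g ∈ S then 1 / (2 * (S.card : ℝ)) else 0)
      (fun g hg => if_neg hg)
    convert h using 1
    rw [Finset.sum_congr rfl fun g hg => if_pos hg, Finset.sum_const, nsmul_eq_mul]
    field_simp
  have hadd := h1.add h2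
  rw [add_halves] at hadd
  exact hadd

lemma convPow_nonneg {P : G → ℝ} (hP : ∀ g, 0 ≤ P g) (n : ℕ) (g : G) :
    0 ≤ convPow P n g := by
  induction n generalizing g with
  | zero => simp only [convPow]; split_ifs <;> norm_num
  | succ n ih => exact tsum_nonneg fun k => mul_nonneg (ih k) (hP _)

lemma support_convPow_finite {P : G → ℝ} (hP : (Function.support P).Finite) (n : ℕ) :
    (Function.support (convPow P n)).Finite := by
  induction n with
  | zero =>
    refine (Set.finite_singleton (1 : G)).subset fun g hg => ?_
    by_contra hne
    exact hg (if_neg hne)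
  | succ n ih =>
    refine (ih.image2 (· * ·) hP).subset fun g hg => ?_
    by_contra hmem
    refine hg ?_
    simp only [convPow]
    convert tsum_zero with k
    by_contra hk
    exact hmem ⟨k, left_ne_zero_of_mul hk, k⁻¹ * g, right_ne_zero_of_mul hk, by simp⟩

lemma hasSum_convPow {P : G → ℝ} (hP : (Function.support P).Finite) (hP1 : HasSum P 1) (n : ℕ) :
    HasSum (convPow P n) 1 := by
  induction n with
  | zero => exact hasSum_ite_eq 1 1
  | succ n ih =>
    set A := (support_convPow_finite hP n).toFinset with hA
    have hzero : ∀ k ∉ A, convPow P n k = 0 := fun k hk => by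
      simpa [hA] using hk
    have heq : convPow P (n + 1) = fun g => ∑ k ∈ A, convPow P n k * P (k⁻¹ * g) := by
      funext g
      exact tsum_eq_sum fun k hk => by rw [hzero k hk, zero_mul]
    have hone : ∑ k ∈ A, convPow P n k * 1 = 1 := by
      simp only [mul_one]
      exact (hasSum_sum_of_ne_finset_zero hzero).unique ih
    rw [heq, ← hone]
    refine hasSum_sum fun k _ => HasSum.mul_left _ ?_
    exact (Equiv.mulLeft k⁻¹).hasSum_iff.mpr hP1

lemma exists_list_prod_eq {S : Finset G} (hsym : ∀ s ∈ S, s⁻¹ ∈ S)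
    (hgen : Subgroup.closure (S : Set G) = ⊤) (g : G) :
    ∃ l : List G, (∀ x ∈ l, x ∈ (S : Set G)) ∧ l.length = wordLength (S : Set G) g ∧
      l.prod = g := by
  have hg : g ∈ (Subgroup.closure (S : Set G)).toSubmonoid := hgen ▸ Subgroup.mem_top g
  rw [Subgroup.closure_toSubmonoid] at hg
  obtain ⟨l, hl, hprod⟩ := Submonoid.exists_list_of_mem_closure hg
  refine Nat.sInf_mem (s := {n | ∃ l : List G, (∀ x ∈ l, x ∈ (S : Set G)) ∧ l.length = n ∧
    l.prod = g}) ⟨l.length, l, fun x hx => ?_, rfl, hprod⟩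
  rcases hl x hx with h | h
  · exact h
  · simpa using hsym _ h

lemma eq_one_of_wordLength_eq_zero {S : Finset G} (hsym : ∀ s ∈ S, s⁻¹ ∈ S)
    (hgen : Subgroup.closure (S : Set G) = ⊤) {g : G} (hg : wordLength (S : Set G) g = 0) :
    g = 1 := by
  obtain ⟨l, -, hlen, rfl⟩ := exists_list_prod_eq hsym hgen g
  rw [hg, List.length_eq_zero_iff] at hlen
  simp [hlen]

lemma ball_finite {S : Finset G} (hsym : ∀ s ∈ S, s⁻¹ ∈ S)
    (hgen : Subgroup.closure (S : Set G) = ⊤) (n : ℕ) : (ball (S : Set G) n).Finite := by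
  refine ((List.finite_length_le S n).image fun l => (l.map Subtype.val).prod).subset
    fun g hg => ?_
  obtain ⟨l, hl, hlen, hprod⟩ := exists_list_prod_eq hsym hgen g
  lift l to List S using hl
  refine ⟨l, ?_, hprod⟩
  rw [List.length_map] at hlen
  exact hlen.trans_le hg

lemma summable_exp_neg_rpow {ν : ℝ} (hν : 0 < ν) :
    Summable fun k : ℕ => Real.exp (-(k : ℝ) ^ ν) := by
  have h := (isLittleO_exp_neg_mul_rpow_atTop one_pos (-2 / ν)).comp_tendsto
    ((tendsto_rpow_atTop hν).comp tendsto_natCast_atTop_atTop)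
  refine summable_of_isBigO_nat (g := fun k : ℕ => (k : ℝ) ^ (-2 : ℝ))
    (Real.summable_nat_rpow.mpr (by norm_num)) ?_
  refine h.isBigO.congr (fun k => by simp) fun k => ?_
  simp only [Function.comp_apply]
  rw [← Real.rpow_mul (Nat.cast_nonneg k), mul_div_cancel₀ _ hν.ne']

/-- Stretched exponential weights that beat the volume growth are uniformly summable. -/
lemma exists_sum_exp_wordLength_le {S : Finset G} (hsym : ∀ s ∈ S, s⁻¹ ∈ S)
    (hgen : Subgroup.closure (S : Set G) = ⊤) {K L ν : ℝ} (hν : 0 < ν)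
    (hvol : ∀ n : ℕ, 1 ≤ n →
      (Nat.card ↥(ball (S : Set G) n) : ℝ) ≤ L * Real.exp (K * (n : ℝ) ^ ν)) :
    ∃ Z : ℝ, ∀ A : Finset G,
      ∑ g ∈ A, Real.exp (-((K + 1) * (wordLength (S : Set G) g : ℝ) ^ ν)) ≤ Z := by
  set f : ℕ → ℝ := fun k =>
    Nat.card ↥(ball (S : Set G) k) * Real.exp (-((K + 1) * (k : ℝ) ^ ν)) with hf
  have hf0 : ∀ k, 0 ≤ f k := fun k => by positivity
  have hfs : Summable f := by
    rw [← summable_nat_add_iff 1]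
    refine Summable.of_nonneg_of_le (fun k => hf0 _) (fun k => ?_)
      (((summable_nat_add_iff 1).mpr (summable_exp_neg_rpow hν)).mul_left L)
    calc f (k + 1) ≤ L * Real.exp (K * ((k + 1 : ℕ) : ℝ) ^ ν) *
          Real.exp (-((K + 1) * ((k + 1 : ℕ) : ℝ) ^ ν)) := by
          simp only [hf]
          gcongr
          exact hvol (k + 1) (by omega)
      _ = L * Real.exp (-((k + 1 : ℕ) : ℝ) ^ ν) := by
          rw [mul_assoc, ← Real.exp_add]
          congr 2
          ring
  refine ⟨∑' k, f k, fun A => ?_⟩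
  rw [← Finset.sum_fiberwise_of_maps_to (t := A.image (wordLength (S : Set G)))
    (fun g hg => Finset.mem_image_of_mem _ hg)]
  refine le_trans (Finset.sum_le_sum fun k _ => ?_) (hfs.sum_le_tsum _ fun k _ => hf0 k)
  rw [Finset.sum_congr rfl (g := fun _ => Real.exp (-((K + 1) * (k : ℝ) ^ ν)))
    fun g hg => by rw [(Finset.mem_filter.mp hg).2], Finset.sum_const, nsmul_eq_mul]
  simp only [hf]
  gcongr
  rw [← Set.ncard_coe_finset, Nat.card_coe_set_eq]
  refine Set.ncard_le_ncard (fun g hg => ?_) (ball_finite hsym hgen k)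
  exact (Finset.mem_filter.mp (Finset.mem_coe.mp hg)).2.le

end Walk

/-- Gibbs' inequality against the (unnormalised) weight `exp (-φ)`. -/
lemma sum_negMulLog_le {α : Type*} (A : Finset α) {q φ : α → ℝ} (hq : ∀ a ∈ A, 0 ≤ q a) :
    -∑ a ∈ A, q a * Real.log (q a) ≤
      ∑ a ∈ A, q a * φ a + ∑ a ∈ A, Real.exp (-φ a) - ∑ a ∈ A, q a := by
  rw [← Finset.sum_neg_distrib, ← Finset.sum_add_distrib, ← Finset.sum_sub_distrib]
  refine Finset.sum_le_sum fun a ha => ?_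
  rcases (hq a ha).eq_or_lt with h0 | hpos
  · rw [← h0]
    simp [Real.exp_nonneg]
  · have h := Real.log_le_sub_one_of_pos (div_pos (Real.exp_pos (-φ a)) hpos)
    rw [Real.log_div (Real.exp_ne_zero _) hpos.ne', Real.log_exp] at h
    have h' := mul_le_mul_of_nonneg_left h hpos.le
    rw [mul_sub, mul_sub, mul_div_cancel₀ _ hpos.ne'] at h'
    linarith

lemma exists_pos_forall_mul_le_of_eventually {u v : ℕ → ℝ} (hu : ∀ n, 1 ≤ n → 0 < u n)
    (hv : ∀ n, 0 ≤ v n) {c : ℝ} (hc : 0 < c) {N : ℕ} (hN : ∀ n, N ≤ n → c * v n ≤ u n) :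
    ∃ c' : ℝ, 0 < c' ∧ ∀ n, 1 ≤ n → c' * v n ≤ u n := by
  induction N generalizing c with
  | zero => exact ⟨c, hc, fun n _ => hN n n.zero_le⟩
  | succ N ih =>
    rcases Nat.eq_zero_or_pos N with rfl | hpos
    · exact ⟨c, hc, hN⟩
    · have hv1 : 0 < v N + 1 := by linarith [hv N]
      refine ih (c := min c (u N / (v N + 1))) (lt_min hc (div_pos (hu N hpos) hv1))
        fun n hn => ?_
      rcases hn.eq_or_lt with rfl | hlt
      · calc min c (u N / (v N + 1)) * v N ≤ u N / (v N + 1) * (v N + 1) := by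
              refine mul_le_mul (min_le_right _ _) (by linarith) (hv N) ?_
              exact (div_pos (hu N hpos) hv1).le
          _ = u N := div_mul_cancel₀ _ hv1.ne'
      · exact (mul_le_mul_of_nonneg_right (min_le_left _ _) (hv n)).trans (hN n hlt)

section Entropy

variable {G : Type*} [Group G]

lemma speed_pos_of_entropy_pos {S : Finset G} (hSne : S.Nonempty) (hsym : ∀ s ∈ S, s⁻¹ ∈ S)
    (hgen : Subgroup.closure (S : Set G) = ⊤) {n : ℕ}
    (hent : 0 < entropy (convPow (lazyWalk S) n)) :
    0 < speed (S : Set G) (lazyWalk S) n := by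
  have hfin := support_convPow_finite (support_lazyWalk_finite S) n
  have hnn := convPow_nonneg (lazyWalk_nonneg S) n
  have hterm : ∀ g, 0 ≤ convPow (lazyWalk S) n g * (wordLength (S : Set G) g : ℝ) :=
    fun g => mul_nonneg (hnn g) (Nat.cast_nonneg _)
  have hsum : Summable fun g => convPow (lazyWalk S) n g * (wordLength (S : Set G) g : ℝ) :=
    summable_of_hasFiniteSupport (hfin.subset fun g hg => left_ne_zero_of_mul hg)
  refine (tsum_nonneg hterm).lt_of_ne fun h0 => hent.ne ?_
  have hz := (hasSum_zero_iff_of_nonneg hterm).mp (h0 ▸ hsum.hasSum)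
  have hne : ∀ g, g ≠ 1 → convPow (lazyWalk S) n g = 0 := fun g hg => by
    rcases mul_eq_zero.mp (congrFun hz g) with h | h
    · exact h
    · exact absurd (eq_one_of_wordLength_eq_zero hsym hgen (by exact_mod_cast h)) hg
  have hone : convPow (lazyWalk S) n 1 = 1 :=
    (hasSum_single 1 hne).unique
      (hasSum_convPow (support_lazyWalk_finite S) (hasSum_lazyWalk hSne) n)
  unfold entropy
  rw [tsum_eq_single 1 fun g hg => by rw [hne g hg, zero_mul], hone]
  simp

lemma entropy_convPow_le {S : Finset G} (hSne : S.Nonempty) {C Z ν : ℝ} (hC : 0 ≤ C)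
    (hν0 : 0 < ν) (hν1 : ν ≤ 1)
    (hZ : ∀ A : Finset G,
      ∑ g ∈ A, Real.exp (-(C * (wordLength (S : Set G) g : ℝ) ^ ν)) ≤ Z) (n : ℕ) :
    entropy (convPow (lazyWalk S) n) ≤ C * speed (S : Set G) (lazyWalk S) n ^ ν + Z := by
  have hnn := convPow_nonneg (lazyWalk_nonneg S) n
  set q := convPow (lazyWalk S) n with hq
  set A := (support_convPow_finite (support_lazyWalk_finite S) n).toFinset with hA
  have hzero : ∀ g ∉ A, q g = 0 := fun g hg => by simpa [hA] using hg
  have hone : ∑ g ∈ A, q g = 1 := (hasSum_sum_of_ne_finset_zero hzero).unique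
    (hasSum_convPow (support_lazyWalk_finite S) (hasSum_lazyWalk hSne) n)
  have hH : entropy q = -∑ g ∈ A, q g * Real.log (q g) := by
    unfold entropy
    rw [tsum_eq_sum fun g hg => by rw [hzero g hg, zero_mul]]
  have hsp : speed (S : Set G) (lazyWalk S) n = ∑ g ∈ A, q g * (wordLength (S : Set G) g : ℝ) :=
    tsum_eq_sum fun g hg => by rw [← hq, hzero g hg, zero_mul]
  have hjensen := (Real.concaveOn_rpow hν0.le hν1).le_map_sum (t := A) (w := q)
    (p := fun g => (wordLength (S : Set G) g : ℝ)) (fun g _ => hnn g) hone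
    (fun g _ => Set.mem_Ici.mpr (Nat.cast_nonneg _))
  simp only [smul_eq_mul] at hjensen
  have hgibbs := sum_negMulLog_le A (q := q)
    (φ := fun g => C * (wordLength (S : Set G) g : ℝ) ^ ν) fun g _ => hnn g
  have hlin : ∑ g ∈ A, q g * (C * (wordLength (S : Set G) g : ℝ) ^ ν) =
      C * ∑ g ∈ A, q g * (wordLength (S : Set G) g : ℝ) ^ ν := by
    rw [Finset.mul_sum]
    exact Finset.sum_congr rfl fun g _ => by ring
  rw [hlin] at hgibbs
  rw [hH, hsp]
  linarith [mul_le_mul_of_nonneg_left hjensen hC, hZ A]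

end Entropy

/-- if `|B_n| ≤ L·exp(K·n^ν)` and `H(P^{(n)}) ≥ K' + L'·n^h`, then
`E|P^{(n)}| ≥ c·n^{h/ν}` (so `β·ν ≥ h`). -/
theorem stmt6 {G : Type*} [Group G] (S : Finset G)
    (hS1 : (1 : G) ∉ S) (hSne : S.Nonempty) (hsym : ∀ s ∈ S, s⁻¹ ∈ S)
    (hgen : Subgroup.closure (S : Set G) = ⊤)
    (K L ν : ℝ) (hK : 0 < K) (hL : 0 < L) (hν0 : 0 < ν) (hν1 : ν ≤ 1)
    (hvol : ∀ n : ℕ, 1 ≤ n →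
      (Nat.card ↥(ball (S : Set G) n) : ℝ) ≤ L * Real.exp (K * (n : ℝ) ^ ν))
    (K' L' h : ℝ) (hK' : 0 < K') (hL' : 0 < L') (hh0 : 0 < h) (hh1 : h ≤ 1)
    (hent : ∀ n : ℕ, 1 ≤ n →
      K' + L' * (n : ℝ) ^ h ≤ entropy (convPow (lazyWalk S) n)) :
    ∃ c : ℝ, 0 < c ∧ ∀ n : ℕ, 1 ≤ n →
      c * (n : ℝ) ^ (h / ν) ≤ speed (S : Set G) (lazyWalk S) n := by
  obtain ⟨Z, hZ⟩ := exists_sum_exp_wordLength_le hsym hgen hν0 hvol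
  have hspeed : ∀ n : ℕ, 1 ≤ n → 0 < speed (S : Set G) (lazyWalk S) n := fun n hn =>
    speed_pos_of_entropy_pos hSne hsym hgen
      (lt_of_lt_of_le (by positivity) (hent n hn))
  have hC : 0 < K + 1 := by linarith
  have hlim : Filter.Tendsto (fun n : ℕ => L' / 2 * (n : ℝ) ^ h) Filter.atTop Filter.atTop :=
    ((tendsto_rpow_atTop hh0).comp tendsto_natCast_atTop_atTop).const_mul_atTop (half_pos hL')
  obtain ⟨N, hN⟩ := Filter.eventually_atTop.mp (hlim.eventually_ge_atTop Z)
  set a : ℝ := L' / (2 * (K + 1)) with ha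
  have ha0 : 0 < a := by positivity
  refine exists_pos_forall_mul_le_of_eventually hspeed (fun n => by positivity)
    (Real.rpow_pos_of_pos ha0 (1 / ν)) (N := N + 1) fun n hn => ?_
  have hn1 : 1 ≤ n := by omega
  have hle : a * (n : ℝ) ^ h ≤ speed (S : Set G) (lazyWalk S) n ^ ν := by
    have h1 := hent n hn1
    have h2 := entropy_convPow_le hSne hC.le hν0 hν1 hZ n
    have h3 := hN n (by omega)
    have h4 : (K + 1) * (a * (n : ℝ) ^ h) = L' / 2 * (n : ℝ) ^ h := by
      rw [ha]
      field_simp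
    refine le_of_mul_le_mul_left ?_ hC
    linarith
  calc a ^ (1 / ν) * (n : ℝ) ^ (h / ν) = (a * (n : ℝ) ^ h) ^ (1 / ν) := by
        rw [Real.mul_rpow ha0.le (by positivity), ← Real.rpow_mul (Nat.cast_nonneg n),
          mul_one_div]
    _ ≤ (speed (S : Set G) (lazyWalk S) n ^ ν) ^ (1 / ν) := by gcongr
    _ = speed (S : Set G) (lazyWalk S) n := by
        rw [← Real.rpow_mul (hspeed n hn1).le, mul_one_div_cancel hν0.ne', Real.rpow_one]
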